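/- Let X be a finite set with n elements and y : 𝒫(X) → ℝ. The combinatorial moment matrix M_n(y), defined by [M_n(y)]_{J,J'} = y(J ∪ J') for J, J' ⊆ X, is positive semidefinite if and only if y lies in the convex cone generated by the characteristic vectors χ^J, J ⊆ X. -/

import Mathlib

/-- The zeta matrix of the Boolean lattice of finite subsets of `X`. -/
def subsetZeta (X : Type*) [DecidableEq X] : Matrix (Finset X) (Finset X) ℝ :=
  Matrix.of fun I J => if I ⊆ J then 1 else 0

/-- The Möbius matrix of the Boolean lattice of finite subsets of `X`. -/
def subsetMoebius (X : Type*) [DecidableEq X] : Matrix (Finset X) (Finset X) ℝ :=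
  Matrix.of fun I J => if I ⊆ J then (-1) ^ (J \ I).card else 0

theorem sum_Icc_neg_one_pow_card_sdiff {X : Type*} [DecidableEq X] {K J : Finset X}
    (h : K ⊆ J) :
    ∑ I ∈ Finset.Icc K J, (-1 : ℝ) ^ (I \ K).card = if K = J then 1 else 0 := by
  have hsum : ∑ I ∈ Finset.Icc K J, (-1 : ℝ) ^ (I \ K).card =
      ∑ I ∈ (J \ K).powerset, (-1 : ℝ) ^ I.card := by
    refine Finset.sum_bij' (fun I _ => I \ K) (fun I _ => K ∪ I) ?_ ?_ ?_ ?_ ?_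
    · intro I hI
      simp only [Finset.mem_Icc, Finset.mem_powerset] at hI ⊢
      exact Finset.sdiff_subset_sdiff hI.2 subset_rfl
    · intro I hI
      simp only [Finset.mem_Icc, Finset.mem_powerset] at hI ⊢
      exact ⟨Finset.subset_union_left,
        Finset.union_subset h (hI.trans Finset.sdiff_subset)⟩
    · intro I hI
      exact Finset.union_sdiff_of_subset (Finset.mem_Icc.1 hI).1
    · intro I hI
      have hI := Finset.mem_powerset.1 hI
      exact Finset.union_sdiff_cancel_left (Finset.disjoint_sdiff.mono_right hI)
    · intro I _
      rfl
  have hcast := congrArg (Int.cast : ℤ → ℝ)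
    (Finset.sum_powerset_neg_one_pow_card (x := J \ K))
  push_cast at hcast
  rw [hsum, hcast]
  refine if_congr ?_ rfl rfl
  rw [Finset.sdiff_eq_empty_iff_subset]
  exact ⟨fun h' => h.antisymm h', fun h' => h'.ge⟩

theorem subsetMoebius_mul_subsetZeta (X : Type*) [Fintype X] [DecidableEq X] :
    subsetMoebius X * subsetZeta X = 1 := by
  ext K J
  have hmul : (subsetMoebius X * subsetZeta X) K J =
      ∑ I ∈ Finset.Icc K J, (-1 : ℝ) ^ (I \ K).card := by
    have hIcc : Finset.Icc K J = Finset.univ.filter fun I => K ⊆ I ∧ I ⊆ J := by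
      ext I
      simp
    rw [hIcc, Finset.sum_filter, Matrix.mul_apply]
    refine Finset.sum_congr rfl fun I _ => ?_
    by_cases h₁ : K ⊆ I <;> by_cases h₂ : I ⊆ J <;>
      simp [subsetMoebius, subsetZeta, h₁, h₂]
  rw [hmul, Matrix.one_apply]
  by_cases h : K ⊆ J
  · exact sum_Icc_neg_one_pow_card_sdiff h
  · rw [Finset.Icc_eq_empty h, Finset.sum_empty, if_neg fun h' => h h'.subset]

theorem subsetZeta_mulVec_eq_sum {X : Type*} [Fintype X] [DecidableEq X] (α : Finset X → ℝ) :
    Matrix.mulVec (subsetZeta X) α =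
      ∑ J : Finset X, α J • (fun J' : Finset X => if J' ⊆ J then (1 : ℝ) else 0) := by
  ext I
  simp [Matrix.mulVec, dotProduct, subsetZeta]

/-- The moment matrix of `∑ J, α J • χ^J` is diagonalized by the zeta matrix. -/
theorem momentMatrix_subsetZeta_mulVec {X : Type*} [Fintype X] [DecidableEq X]
    (α : Finset X → ℝ) :
    (Matrix.of fun J J' : Finset X => Matrix.mulVec (subsetZeta X) α (J ∪ J')) =
      subsetZeta X * Matrix.diagonal α * (subsetZeta X).conjTranspose := by
  ext I I'
  rw [Matrix.mul_apply]
  simp only [Matrix.of_apply, Matrix.mulVec, dotProduct, Matrix.mul_diagonal,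
    Matrix.conjTranspose_apply, star_trivial]
  refine Finset.sum_congr rfl fun J _ => ?_
  by_cases h₁ : I ⊆ J <;> by_cases h₂ : I' ⊆ J <;>
    simp [subsetZeta, Finset.union_subset_iff, h₁, h₂]

/-- M_n(y) ⪰ 0 iff y lies in the cone generated by the characteristic vectors. -/
theorem moment_matrix_psd_iff_cone {X : Type*} [Fintype X] [DecidableEq X]
    (y : Finset X → ℝ) :
    (Matrix.of fun J J' : Finset X => y (J ∪ J')).PosSemidef ↔
      ∃ α : Finset X → ℝ, (∀ J, 0 ≤ α J) ∧
        y = ∑ J : Finset X, α J • (fun J' : Finset X => if J' ⊆ J then (1 : ℝ) else 0) := by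
  have hinv := subsetMoebius_mul_subsetZeta X
  simp_rw [← subsetZeta_mulVec_eq_sum]
  constructor
  · intro h
    obtain ⟨α, rfl⟩ : ∃ α, y = Matrix.mulVec (subsetZeta X) α :=
      ⟨Matrix.mulVec (subsetMoebius X) y, by
        rw [Matrix.mulVec_mulVec, mul_eq_one_comm.1 hinv, Matrix.one_mulVec]⟩
    refine ⟨α, Matrix.posSemidef_diagonal_iff.1 ?_, rfl⟩
    rw [momentMatrix_subsetZeta_mulVec] at h
    have hdiag : subsetMoebius X *
        (subsetZeta X * Matrix.diagonal α * (subsetZeta X).conjTranspose) *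
          (subsetMoebius X).conjTranspose = Matrix.diagonal α := by
      rw [← mul_assoc, ← mul_assoc, hinv, one_mul, mul_assoc, ← Matrix.conjTranspose_mul,
        hinv, Matrix.conjTranspose_one, mul_one]
    rw [← hdiag]
    exact h.mul_mul_conjTranspose_same _
  · rintro ⟨α, hα, rfl⟩
    rw [momentMatrix_subsetZeta_mulVec]
    exact (Matrix.PosSemidef.diagonal hα).mul_mul_conjTranspose_same _
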